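/- arXiv:2103.09064 — 2 statements merged into one kernel-verified Lean document; each statement's English description precedes it below -/
import Mathlib

section
/- Let q > 2 be a prime power and k a positive integer. Then G ∘ F is the identity map on 𝔽_q^k; consequently F and G are mutually inverse bijections of 𝔽_q^k. -/
/-- The sequence `c_{i,j}` from the paper: `c_{i,0} = 0` and
`c_{i,j} = c_{i,j-1}^{q-2} + a_{i-j+1}` (indices of `a` are 0-based here). -/
def cRec {F : Type*} [Field F] (q : ℕ) {k : ℕ} (a : Fin k → F) (i : Fin k) : ℕ → F
  | 0 => 0
  | j + 1 => (cRec q a i j) ^ (q - 2)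
      + a ⟨i.val - j, lt_of_le_of_lt (Nat.sub_le _ _) i.isLt⟩

/-- The map F : 𝔽_q^k → 𝔽_q^k, sending (a₁,…,a_k) to (c_{1,1},…,c_{k,k}). -/
def Fvec {F : Type*} [Field F] (q : ℕ) {k : ℕ} (a : Fin k → F) : Fin k → F :=
  fun i => cRec q a i (i.val + 1)

/-- The map G : 𝔽_q^k → 𝔽_q^k, where the i-th entry of `G(b)` is the first entry of
`(Φ_{k-i+2} ∘ ⋯ ∘ Φ_k)(b)`, with `Φ_ℓ(e₁,…,e_ℓ) = ((e₂−e₁)^{q−2}, …, (e_ℓ−e₁)^{q−2})`. -/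
def Gvec {F : Type*} [Field F] (q : ℕ) : (m : ℕ) → (Fin m → F) → Fin m → F
  | 0, _ => finZeroElim
  | m + 1, b => Fin.cons (b 0) (Gvec q m (fun j => (b j.succ - b 0) ^ (q - 2)))

theorem FiniteField.pow_card_sub_two_eq_inv {F : Type*} [Field F] [Fintype F]
    (hq : 2 < Fintype.card F) (x : F) : x ^ (Fintype.card F - 2) = x⁻¹ := by
  by_cases hx : x = 0
  · simp [hx, Nat.sub_ne_zero_of_lt hq]
  · refine eq_inv_of_mul_eq_one_left ?_
    rw [← pow_succ, show Fintype.card F - 2 + 1 = Fintype.card F - 1 by omega,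
      FiniteField.pow_card_sub_one_eq_one x hx]

theorem cRec_succ_eq_cRec_tail {F : Type*} [Field F] (q : ℕ) {m : ℕ} (a : Fin (m + 1) → F)
    (i : Fin m) {n : ℕ} (hn : n ≤ i.val + 1) :
    cRec q a i.succ n = cRec q (Fin.tail a) i n := by
  induction n with
  | zero => rfl
  | succ n ih =>
    rw [cRec, cRec, ih (by omega), Fin.tail]
    congr 2
    ext
    simp only [Fin.val_succ]
    omega

theorem Fvec_zero {F : Type*} [Field F] {q : ℕ} (hq : 2 < q) {m : ℕ} (a : Fin (m + 1) → F) :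
    Fvec q a 0 = a 0 := by
  simp [Fvec, cRec, Nat.sub_ne_zero_of_lt hq]

theorem Fvec_succ {F : Type*} [Field F] (q : ℕ) {m : ℕ} (a : Fin (m + 1) → F) (i : Fin m) :
    Fvec q a i.succ = Fvec q (Fin.tail a) i ^ (q - 2) + a 0 := by
  simp [Fvec, cRec, cRec_succ_eq_cRec_tail q a i le_rfl]

theorem Gvec_Fvec {F : Type*} [Field F] [Fintype F] (hq : 2 < Fintype.card F) (k : ℕ)
    (a : Fin k → F) : Gvec (Fintype.card F) k (Fvec (Fintype.card F) a) = a := by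
  induction k with
  | zero => exact Subsingleton.elim _ _
  | succ m ih =>
    simp only [Gvec, Fvec_zero hq, Fvec_succ, add_sub_cancel_right,
      FiniteField.pow_card_sub_two_eq_inv hq, inv_inv]
    rw [ih (Fin.tail a), Fin.cons_self_tail]

/-- G ∘ F is the identity on 𝔽_q^k; consequently F and G are mutually
inverse bijections of 𝔽_q^k. -/
theorem Gvec_Fvec_inverse
    {F : Type*} [Field F] [Fintype F]
    (hq : 2 < Fintype.card F) (k : ℕ) (hk : 0 < k) :
    (∀ a : Fin k → F, Gvec (Fintype.card F) k (Fvec (Fintype.card F) a) = a) ∧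
    (∀ b : Fin k → F, Fvec (Fintype.card F) (Gvec (Fintype.card F) k b) = b) ∧
    Function.Bijective (fun a : Fin k → F => Fvec (Fintype.card F) a) ∧
    Function.Bijective (Gvec (Fintype.card F) k : (Fin k → F) → Fin k → F) := by
  have hGF : Function.LeftInverse (Gvec (Fintype.card F) k)
      (fun a : Fin k → F => Fvec (Fintype.card F) a) := Gvec_Fvec hq k
  have hF := Finite.injective_iff_bijective.mp hGF.injective
  have hFG := hGF.rightInverse_of_surjective hF.surjective
  exact ⟨hGF, hFG, hF, hFG.injective, hGF.surjective⟩
end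

section
/- Let q > 2 be a prime power and let f = μ ∘ σ be a permutation of 𝔽_q (extended to ℙ¹(𝔽_q) fixing ∞), where μ is a permutation of ℙ¹(𝔽_q) induced by a degree-one rational function and σ is a permutation of ℙ¹(𝔽_q) which moves exactly s points of 𝔽_q and has exactly t nontrivial orbits on ℙ¹(𝔽_q). Define n := s + t if σ(∞) = ∞ and n := s + t − 1 if σ(∞) ≠ ∞. If q ≥ n + s + 2, then the Carlitz rank of f is exactly n. -/
/-- A permutation of 𝔽_q is induced by a degree-one polynomial if it acts as x ↦ αx + β
for some α ≠ 0. -/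
def IsAffinePerm {F : Type*} [Field F] (π : Equiv.Perm F) : Prop :=
  ∃ α β : F, α ≠ 0 ∧ ∀ x, π x = α * x + β

/-- `f` admits a representation `f = θ₀ ∘ ρ ∘ θ₁ ∘ ρ ∘ ⋯ ∘ ρ ∘ θ_n` with each θᵢ induced
by a degree-one polynomial.  The Carlitz rank of `f` is the least such `n`. -/
def HasCRRep {F : Type*} [Field F] (ρ f : Equiv.Perm F) (n : ℕ) : Prop :=
  ∃ θ : Fin (n + 1) → Equiv.Perm F, (∀ i, IsAffinePerm (θ i)) ∧
    f = θ 0 * (List.ofFn (fun i : Fin n => ρ * θ i.succ)).prod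

/-- The action of the degree-one rational function (αx+β)/(γx+δ) on ℙ¹(𝔽_q),
modeled as `Option F` with `none` as ∞. -/
def mobiusFun {F : Type*} [Field F] [DecidableEq F] (α β γ δ : F) : Option F → Option F
  | none => if γ = 0 then none else some (α / γ)
  | some x => if γ * x + δ = 0 then none else some ((α * x + β) / (γ * x + δ))

/-- A permutation of ℙ¹(𝔽_q) is induced by a degree-one rational function if it acts as
some (αx+β)/(γx+δ) with αδ − βγ ≠ 0. -/
def IsMobius {F : Type*} [Field F] [DecidableEq F] (m : Equiv.Perm (Option F)) : Prop :=
  ∃ α β γ δ : F, α * δ - β * γ ≠ 0 ∧ ∀ x, m x = mobiusFun α β γ δ x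

namespace Equiv.Perm

variable {X : Type*}

/-- The orbit of `x` under the iterates of `σ`. -/
def zpowOrbit (σ : Perm X) (x : X) : Set X :=
  Set.range fun m : ℤ => (σ ^ m) x

/-- The number of orbits of `σ`, trivial ones included. -/
noncomputable def numOrbits (σ : Perm X) : ℕ :=
  (Set.range (zpowOrbit σ)).ncard

theorem mem_zpowOrbit_self (σ : Perm X) (x : X) : x ∈ zpowOrbit σ x :=
  ⟨0, by simp⟩

theorem zpowOrbit_apply (σ : Perm X) (x : X) : zpowOrbit σ (σ x) = zpowOrbit σ x := by
  ext y
  constructor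
  · rintro ⟨m, rfl⟩
    exact ⟨m + 1, by simp [zpow_add]⟩
  · rintro ⟨m, rfl⟩
    refine ⟨m - 1, ?_⟩
    have h : (σ ^ (m - 1) * σ) x = (σ ^ m) x := by rw [← zpow_add_one, sub_add_cancel]
    exact h

theorem zpowOrbit_of_apply_eq {σ : Perm X} {x : X} (h : σ x = x) : zpowOrbit σ x = {x} := by
  ext y
  simp only [zpowOrbit, Set.mem_range, Set.mem_singleton_iff]
  constructor
  · rintro ⟨m, rfl⟩
    exact zpow_apply_eq_self_of_apply_eq_self h m
  · rintro rfl
    exact ⟨0, by simp⟩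

theorem eq_of_mem_zpowOrbit {Y : Type*} {σ : Perm X} {ψ : X → Y} (h : ∀ x, ψ (σ x) = ψ x)
    {x y : X} (hy : y ∈ zpowOrbit σ x) : ψ y = ψ x := by
  obtain ⟨m, rfl⟩ := hy
  dsimp only
  induction m with
  | zero => simp
  | succ k ih =>
    rw [← ih, ← h ((σ ^ (k : ℤ)) x), ← mul_apply, ← zpow_one_add, add_comm]
  | pred k ih =>
    rw [← ih, ← h ((σ ^ (-(k : ℤ) - 1)) x), ← mul_apply, ← zpow_one_add, add_sub_cancel]

open Classical in
/-- The orbit map of `σ`, with the orbit of `a` replaced by that of `b`. -/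
noncomputable def mergedOrbit (σ : Perm X) (a b x : X) : Set X :=
  if zpowOrbit σ x = zpowOrbit σ a then zpowOrbit σ b else zpowOrbit σ x

theorem mergedOrbit_apply (σ : Perm X) (a b x : X) :
    mergedOrbit σ a b (σ x) = mergedOrbit σ a b x := by
  simp [mergedOrbit, zpowOrbit_apply]

theorem mergedOrbit_left_eq_right (σ : Perm X) (a b : X) :
    mergedOrbit σ a b a = mergedOrbit σ a b b := by
  simp [mergedOrbit]

theorem ncard_range_le_mergedOrbit [Finite X] {Y : Type*} {σ : Perm X} {a b : X} {ψ : X → Y}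
    (h : ∀ x, ψ (σ x) = ψ x) (hab : ψ a = ψ b) :
    (Set.range ψ).ncard ≤ (Set.range (mergedOrbit σ a b)).ncard := by
  have hf : ψ.FactorsThrough (mergedOrbit σ a b) := by
    have key : ∀ x, ∀ y ∈ mergedOrbit σ a b x, ψ y = ψ x := by
      intro x y hy
      unfold mergedOrbit at hy
      split_ifs at hy with hx
      · rw [eq_of_mem_zpowOrbit h hy, ← hab]
        exact (eq_of_mem_zpowOrbit h (hx ▸ mem_zpowOrbit_self σ x)).symm
      · exact eq_of_mem_zpowOrbit h hy
    have hne : ∀ x, (mergedOrbit σ a b x).Nonempty := by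
      intro x
      unfold mergedOrbit
      split_ifs
      exacts [⟨b, mem_zpowOrbit_self σ b⟩, ⟨x, mem_zpowOrbit_self σ x⟩]
    intro x y hxy
    obtain ⟨z, hz⟩ := hne x
    rw [← key x z hz, key y z (hxy ▸ hz)]
  have : Nonempty Y := ⟨ψ a⟩
  obtain ⟨e, he⟩ := (Function.factorsThrough_iff ψ).1 hf
  rw [he, Set.range_comp]
  exact Set.ncard_image_le (Set.finite_range _)

theorem ncard_range_mergedOrbit [Finite X] (σ : Perm X) (a b : X)
    [Decidable (zpowOrbit σ a = zpowOrbit σ b)] :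
    (Set.range (mergedOrbit σ a b)).ncard + (if zpowOrbit σ a = zpowOrbit σ b then 0 else 1) =
      numOrbits σ := by
  split_ifs with hab
  · rw [numOrbits, add_zero]
    congr 2
    ext1 x
    unfold mergedOrbit
    split_ifs with hx
    · rw [hx, hab]
    · rfl
  · have : Set.range (mergedOrbit σ a b) = Set.range (zpowOrbit σ) \ {zpowOrbit σ a} := by
      ext o
      constructor
      · rintro ⟨x, rfl⟩
        unfold mergedOrbit
        split_ifs with hx
        · exact ⟨⟨b, rfl⟩, Ne.symm hab⟩
        · exact ⟨⟨x, rfl⟩, hx⟩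
      · rintro ⟨⟨x, rfl⟩, hx⟩
        exact ⟨x, if_neg hx⟩
    rw [this, Set.ncard_sdiff_singleton_add_one (Set.mem_range_self a) (Set.finite_range _),
      numOrbits]

variable [DecidableEq X]

theorem apply_mul_swap_of_invariant {Y : Type*} {σ : Perm X} {ψ : X → Y}
    (h : ∀ x, ψ (σ x) = ψ x) {a b : X} (hab : ψ a = ψ b) (x : X) :
    ψ ((σ * swap a b) x) = ψ x := by
  rw [mul_apply, h]
  by_cases ha : x = a
  · simp [ha, hab]
  by_cases hb : x = b
  · simp [hb, hab]
  rw [swap_apply_of_ne_of_ne ha hb]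

theorem ncard_range_mergedOrbit_mul_swap [Finite X] (σ : Perm X) (a b : X) :
    (Set.range (mergedOrbit (σ * swap a b) a b)).ncard =
      (Set.range (mergedOrbit σ a b)).ncard := by
  have key : ∀ τ : Perm X, (Set.range (mergedOrbit τ a b)).ncard ≤
      (Set.range (mergedOrbit (τ * swap a b) a b)).ncard := fun τ =>
    ncard_range_le_mergedOrbit
      (apply_mul_swap_of_invariant (mergedOrbit_apply τ a b) (mergedOrbit_left_eq_right τ a b))
      (mergedOrbit_left_eq_right τ a b)
  refine le_antisymm ?_ (key σ)
  simpa [mul_assoc] using key (σ * swap a b)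

theorem numOrbits_mul_swap_le [Finite X] (σ : Perm X) (a b : X) :
    numOrbits (σ * swap a b) ≤ numOrbits σ + 1 := by
  classical
  have h1 := ncard_range_mergedOrbit σ a b
  have h2 := ncard_range_mergedOrbit (σ * swap a b) a b
  rw [ncard_range_mergedOrbit_mul_swap] at h2
  split_ifs at h1 h2 <;> omega

theorem numOrbits_mul_swap_of_apply_eq [Finite X] {σ : Perm X} {a b : X} (hab : a ≠ b)
    (ha : σ a = a) : numOrbits (σ * swap a b) + 1 = numOrbits σ := by
  classical
  have h1 := ncard_range_mergedOrbit σ a b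
  have h2 := ncard_range_mergedOrbit (σ * swap a b) a b
  rw [ncard_range_mergedOrbit_mul_swap] at h2
  rw [if_neg] at h1
  · rw [if_pos] at h2
    · omega
    · simpa [ha] using zpowOrbit_apply (σ * swap a b) b
  · intro h
    have := mem_zpowOrbit_self σ b
    rw [← h, zpowOrbit_of_apply_eq ha] at this
    exact hab this.symm

theorem numOrbits_eq_ncard_add_card_fixed [Fintype X] (σ : Perm X) :
    numOrbits σ = {o : Set X | ∃ x, σ x ≠ x ∧ o = zpowOrbit σ x}.ncard +
      (Finset.univ.filter fun x => σ x = x).card := by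
  have hsplit : Set.range (zpowOrbit σ) = {o : Set X | ∃ x, σ x ≠ x ∧ o = zpowOrbit σ x} ∪
      (fun x => ({x} : Set X)) '' {x | σ x = x} := by
    ext o
    constructor
    · rintro ⟨x, rfl⟩
      by_cases hx : σ x = x
      · exact Or.inr ⟨x, hx, (zpowOrbit_of_apply_eq hx).symm⟩
      · exact Or.inl ⟨x, hx, rfl⟩
    · rintro (⟨x, -, rfl⟩ | ⟨x, hx, rfl⟩)
      · exact ⟨x, rfl⟩
      · exact ⟨x, zpowOrbit_of_apply_eq hx⟩
  have hdisj : _root_.Disjoint {o : Set X | ∃ x, σ x ≠ x ∧ o = zpowOrbit σ x}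
      ((fun x => ({x} : Set X)) '' {x | σ x = x}) := by
    rw [Set.disjoint_left]
    rintro o ⟨x, hx, rfl⟩ ⟨y, hy, hxy⟩
    have : x ∈ ({y} : Set X) := by
      rw [show ({y} : Set X) = zpowOrbit σ x from hxy]
      exact mem_zpowOrbit_self σ x
    obtain rfl : x = y := this
    exact hx hy
  rw [numOrbits, hsplit, Set.ncard_union_eq hdisj (Set.toFinite _) (Set.toFinite _),
    Set.ncard_image_of_injective _ Set.singleton_injective, ← Set.ncard_coe_finset]
  simp

theorem numOrbits_one [Fintype X] : numOrbits (1 : Perm X) = Fintype.card X := by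
  rw [numOrbits_eq_ncard_add_card_fixed]
  simp

end Equiv.Perm

section StarFactorization

open Equiv Equiv.Perm

variable {F : Type*} [DecidableEq F]

/-- The product of the transpositions `(b ∞)` for `b` in the list `l`. -/
def starProd (l : List F) : Perm (Option F) :=
  (l.map fun b => swap (some b) none).prod

theorem starProd_append_singleton (l : List F) (b : F) :
    starProd (l ++ [b]) = starProd l * swap (some b) none := by
  simp [starProd]

variable [Fintype F]

/-- The elements of `F` moved by a permutation of `Option F`. -/
def movedSome (σ : Perm (Option F)) : Finset F :=
  Finset.univ.filter fun x : F => σ (some x) ≠ some x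

theorem mem_movedSome {σ : Perm (Option F)} {x : F} :
    x ∈ movedSome σ ↔ σ (some x) ≠ some x := by
  simp only [movedSome, Finset.mem_filter, Finset.mem_univ, true_and]

theorem movedSome_starProd_subset (l : List F) : movedSome (starProd l) ⊆ l.toFinset := by
  induction l with
  | nil => simp [movedSome, starProd]
  | cons b l ih =>
    intro x hx
    by_contra hxl
    simp only [List.toFinset_cons, Finset.mem_insert, not_or] at hxl
    have h : x ∉ movedSome (starProd l) := fun h => hxl.2 (ih h)
    rw [mem_movedSome, not_not] at h
    rw [mem_movedSome, starProd, List.map_cons, List.prod_cons, mul_apply, ← starProd, h] at hx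
    exact hx (swap_apply_of_ne_of_ne (by simpa using hxl.1) (Option.some_ne_none x))

theorem mem_movedSome_mul_swap_of_ne (σ : Perm (Option F)) {b x : F} (h : x ≠ b) :
    x ∈ movedSome (σ * swap (some b) none) ↔ x ∈ movedSome σ := by
  have : swap (some b) none (some x) = some x :=
    swap_apply_of_ne_of_ne (by simpa using h) (by simp)
  simp [mem_movedSome, this]

theorem mem_movedSome_mul_swap_self (σ : Perm (Option F)) (b : F) :
    b ∈ movedSome (σ * swap (some b) none) ↔ σ none ≠ some b := by
  simp [mem_movedSome]

/-- The number of transpositions `(b ∞)` needed to write `σ`; see `starLength_starProd_le` and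
`exists_starProd`. -/
noncomputable def starLength (σ : Perm (Option F)) : ℤ :=
  2 * (movedSome σ).card + numOrbits σ - (Fintype.card F + 1)

theorem starLength_mul_swap_le (σ : Perm (Option F)) (b : F) :
    starLength (σ * swap (some b) none) ≤ starLength σ + 1 := by
  unfold starLength
  by_cases hb : σ (some b) = some b
  · have h1 := numOrbits_mul_swap_of_apply_eq (Option.some_ne_none b) hb
    have h2 : (movedSome (σ * swap (some b) none)).card ≤ (movedSome σ).card + 1 := by
      refine (Finset.card_le_card fun x hx => ?_).trans (Finset.card_insert_le b _)
      by_cases hxb : x = b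
      · simp [hxb]
      · exact Finset.mem_insert_of_mem ((mem_movedSome_mul_swap_of_ne σ hxb).1 hx)
    omega
  · have h1 := numOrbits_mul_swap_le σ (some b) none
    have h2 : (movedSome (σ * swap (some b) none)).card ≤ (movedSome σ).card := by
      refine Finset.card_le_card fun x hx => ?_
      by_cases hxb : x = b
      · simp [hxb, mem_movedSome, hb]
      · exact (mem_movedSome_mul_swap_of_ne σ hxb).1 hx
    omega

theorem starLength_starProd_le (l : List F) : starLength (starProd l) ≤ l.length := by
  induction l using List.reverseRecOn with
  | nil => simp [starLength, starProd, movedSome, numOrbits_one]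
  | append_singleton l b ih =>
    rw [starProd_append_singleton]
    have := starLength_mul_swap_le (starProd l) b
    simp only [List.length_append, List.length_singleton]
    push_cast
    omega

theorem exists_starLength_mul_swap {σ : Perm (Option F)} (hσ : σ ≠ 1) :
    ∃ b : F, starLength (σ * swap (some b) none) + 1 = starLength σ := by
  unfold starLength
  rcases h : σ none with _ | b
  · obtain ⟨b, hb⟩ : ∃ b : F, σ (some b) ≠ some b := by
      by_contra! hall
      exact hσ (Perm.ext fun x => by cases x <;> simp [h, hall])
    refine ⟨b, ?_⟩
    have h1 := numOrbits_mul_swap_of_apply_eq (Option.some_ne_none b).symm h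
    rw [swap_comm] at h1
    have h2 : movedSome (σ * swap (some b) none) = movedSome σ := by
      ext x
      by_cases hxb : x = b
      · subst hxb
        rw [mem_movedSome_mul_swap_self]
        simp [h, mem_movedSome, hb]
      · exact mem_movedSome_mul_swap_of_ne σ hxb
    rw [h2]
    omega
  · refine ⟨b, ?_⟩
    have hfix : (σ * swap (some b) none) (some b) = some b := by simp [h]
    have h1 := numOrbits_mul_swap_of_apply_eq (Option.some_ne_none b) hfix
    rw [mul_assoc, swap_mul_self, mul_one] at h1
    have hb : b ∈ movedSome σ := by
      have : σ (some b) ≠ some b := fun hb => by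
        simpa using σ.injective (hb.trans h.symm)
      simpa [mem_movedSome] using this
    have h2 : movedSome (σ * swap (some b) none) = (movedSome σ).erase b := by
      ext x
      by_cases hxb : x = b
      · subst hxb
        rw [mem_movedSome_mul_swap_self]
        simp [h]
      · rw [mem_movedSome_mul_swap_of_ne σ hxb]
        simp [hxb]
    have h3 := Finset.card_erase_add_one hb
    rw [h2]
    omega

theorem starLength_eq (σ : Perm (Option F)) :
    starLength σ = (movedSome σ).card +
      ({o : Set (Option F) | ∃ x, σ x ≠ x ∧ o = zpowOrbit σ x}.ncard : ℤ) -
        if σ none = none then 0 else 1 := by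
  have h1 := numOrbits_eq_ncard_add_card_fixed σ
  have h2 : (Finset.univ.filter fun x => σ x = x).card + (movedSome σ).card =
      Fintype.card F + if σ none = none then 1 else 0 := by
    have h3 := Finset.card_filter_add_card_filter_not (s := (Finset.univ : Finset F))
      (fun x : F => σ (some x) = some x)
    rw [Finset.card_univ] at h3
    rw [← h3, Finset.card_filter, Fintype.sum_option, ← Finset.card_filter, movedSome]
    ring
  unfold starLength
  split_ifs at h2 ⊢ <;> omega

theorem ncard_nontrivial_orbits_pos {X : Type*} [Finite X] {σ : Perm X} {x : X} (hx : σ x ≠ x) :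
    0 < {o : Set X | ∃ x, σ x ≠ x ∧ o = zpowOrbit σ x}.ncard :=
  (Set.ncard_pos (Set.toFinite _)).2 ⟨_, x, hx, rfl⟩

theorem starLength_nonneg (σ : Perm (Option F)) : 0 ≤ starLength σ := by
  rw [starLength_eq]
  split_ifs with h
  · omega
  · have := ncard_nontrivial_orbits_pos h
    omega

theorem exists_starProd (σ : Perm (Option F)) :
    ∃ l : List F, starProd l = σ ∧ (l.length : ℤ) = starLength σ := by
  obtain ⟨k, hk⟩ := Int.eq_ofNat_of_zero_le (starLength_nonneg σ)
  induction k generalizing σ with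
  | zero =>
    by_cases hσ : σ = 1
    · exact ⟨[], by simp [starProd, hσ], by simp [hk]⟩
    · obtain ⟨b, hb⟩ := exists_starLength_mul_swap hσ
      have := starLength_nonneg (σ * swap (some b) none)
      omega
  | succ k ih =>
    by_cases hσ : σ = 1
    · have : starLength (1 : Perm (Option F)) ≤ 0 := starLength_starProd_le []
      rw [hσ] at hk
      omega
    · obtain ⟨b, hb⟩ := exists_starLength_mul_swap hσ
      obtain ⟨l, hl, hlen⟩ := ih (σ * swap (some b) none) (by omega)
      refine ⟨l ++ [b], ?_, ?_⟩
      · rw [starProd_append_singleton, hl, mul_assoc, swap_mul_self, mul_one]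
      · simp only [List.length_append, List.length_singleton]
        push_cast
        omega

end StarFactorization

section Mobius

open Equiv Equiv.Perm

variable {F : Type*} [Field F] [DecidableEq F]

theorem num_ne_zero_of_denom_eq_zero {a b c d x : F} (h : a * d - b * c ≠ 0)
    (hx : c * x + d = 0) : a * x + b ≠ 0 := by
  intro h0
  by_cases hc : c = 0
  · subst hc
    have hd : d = 0 := by simpa using hx
    simp [hd] at h
  · apply h
    have : c * (a * d - b * c) = 0 := by
      linear_combination (a * c) * hx - c ^ 2 * h0
    simpa [hc] using this

theorem mobiusFun_ratio (a b c d : F) {u v : F} (huv : v = 0 → u ≠ 0) :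
    mobiusFun a b c d (if v = 0 then none else some (u / v)) =
      if c * u + d * v = 0 then none else some ((a * u + b * v) / (c * u + d * v)) := by
  by_cases hv : v = 0
  · subst hv
    by_cases hc : c = 0
    · simp [hc, mobiusFun]
    · simp [hc, huv rfl, mobiusFun, mul_div_mul_right]
  · have e : c * (u / v) + d = (c * u + d * v) / v := by field_simp
    have e' : a * (u / v) + b = (a * u + b * v) / v := by field_simp
    rw [if_neg hv, mobiusFun, e, e', div_div_div_cancel_right₀ hv]
    simp only [div_eq_zero_iff, hv, or_false]

theorem IsMobius.mul {m₁ m₂ : Perm (Option F)} (h₁ : IsMobius m₁) (h₂ : IsMobius m₂) :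
    IsMobius (m₁ * m₂) := by
  obtain ⟨a, b, c, d, h, hm⟩ := h₁
  obtain ⟨a', b', c', d', h', hm'⟩ := h₂
  refine ⟨a * a' + b * c', a * b' + b * d', c * a' + d * c', c * b' + d * d', ?_, fun x => ?_⟩
  · have : (a * d - b * c) * (a' * d' - b' * c') ≠ 0 := mul_ne_zero h h'
    intro h0
    apply this
    linear_combination h0
  · rw [mul_apply, hm', hm]
    cases x with
    | none =>
      refine mobiusFun_ratio a b c d fun hc ha => h' ?_
      rw [hc, ha]
      ring
    | some x =>
      refine (mobiusFun_ratio a b c d fun hx => num_ne_zero_of_denom_eq_zero h' hx).trans ?_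
      rw [mobiusFun]
      ring_nf

theorem mobiusFun_some_eq_iff {a b c d a' b' c' d' x : F} (h : a * d - b * c ≠ 0)
    (h' : a' * d' - b' * c' ≠ 0) :
    mobiusFun a b c d (some x) = mobiusFun a' b' c' d' (some x) ↔
      (a * x + b) * (c' * x + d') = (a' * x + b') * (c * x + d) := by
  have hn := num_ne_zero_of_denom_eq_zero (x := x) h
  have hn' := num_ne_zero_of_denom_eq_zero (x := x) h'
  simp only [mobiusFun]
  by_cases hz : c * x + d = 0 <;> by_cases hz' : c' * x + d' = 0
  · simp [hz, hz']
  · simp [hz, hz', hn hz]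
  · simp [hz, hz', hn' hz']
  · simp only [if_neg hz, if_neg hz', Option.some.injEq]
    rw [div_eq_div_iff hz hz']

theorem IsMobius.eq_of_three_points {m₁ m₂ : Perm (Option F)} (h₁ : IsMobius m₁)
    (h₂ : IsMobius m₂) {x y z : F} (hxy : x ≠ y) (hxz : x ≠ z) (hyz : y ≠ z)
    (hx : m₁ (some x) = m₂ (some x)) (hy : m₁ (some y) = m₂ (some y))
    (hz : m₁ (some z) = m₂ (some z)) : m₁ = m₂ := by
  obtain ⟨a, b, c, d, h, hm⟩ := h₁
  obtain ⟨a', b', c', d', h', hm'⟩ := h₂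
  rw [hm, hm', mobiusFun_some_eq_iff h h'] at hx hy hz
  have hA : a * c' = a' * c := by
    have : (x - y) * (x - z) * (y - z) * (a * c' - a' * c) = 0 := by
      linear_combination (y - z) * hx - (x - z) * hy + (x - y) * hz
    simpa [sub_eq_zero, hxy, hxz, hyz] using this
  have hB : a * d' + b * c' = a' * d + b' * c := by
    have : (x - y) * (a * d' + b * c' - (a' * d + b' * c)) = 0 := by
      linear_combination hx - hy - (x ^ 2 - y ^ 2) * hA
    simpa [sub_eq_zero, hxy] using this
  have hC : b * d' = b' * d := by
    linear_combination hx - x ^ 2 * hA - x * hB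
  ext1 w
  rw [hm, hm']
  cases w with
  | none =>
    simp only [mobiusFun]
    by_cases hc : c = 0 <;> by_cases hc' : c' = 0
    · simp [hc, hc']
    · subst hc
      have : a = 0 := by simpa [hc'] using hA
      simp [this] at h
    · subst hc'
      have : a' = 0 := by simpa [hc] using hA.symm
      simp [this] at h'
    · simp only [if_neg hc, if_neg hc', Option.some.injEq]
      rw [div_eq_div_iff hc hc', hA]
  | some w =>
    rw [mobiusFun_some_eq_iff h h']
    linear_combination w ^ 2 * hA + w * hB + hC

theorem IsAffinePerm.isMobius_optionCongr {θ : Perm F} (h : IsAffinePerm θ) :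
    IsMobius θ.optionCongr := by
  obtain ⟨a, b, ha, hθ⟩ := h
  refine ⟨a, b, 0, 1, by simpa using ha, fun x => ?_⟩
  cases x <;> simp [mobiusFun, hθ]

theorem IsMobius.isAffinePerm {f : Perm F} (h : IsMobius f.optionCongr) : IsAffinePerm f := by
  obtain ⟨a, b, c, d, h, hm⟩ := h
  have hc : c = 0 := by
    by_contra hc
    simpa [mobiusFun, hc] using hm none
  subst hc
  have had : a ≠ 0 ∧ d ≠ 0 := by simpa using h
  refine ⟨a / d, b / d, div_ne_zero had.1 had.2, fun x => ?_⟩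
  have := hm (some x)
  simp only [mobiusFun, optionCongr_apply, Option.map_some, zero_mul, zero_add, if_neg had.2,
    Option.some.injEq] at this
  rw [this]
  ring

/-- The map `x ↦ 1 / x` on the projective line. -/
def mobiusInv : Perm (Option F) :=
  (Equiv.inv F).optionCongr * swap (some 0) none

theorem isMobius_mobiusInv : IsMobius (mobiusInv : Perm (Option F)) := by
  refine ⟨0, 1, 1, 0, by simp, fun x => ?_⟩
  cases x with
  | none => simp [mobiusFun, mobiusInv]
  | some x =>
    by_cases hx : x = 0
    · simp [mobiusFun, mobiusInv, hx]
    · have : swap (some 0) none (some x) = some x :=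
        swap_apply_of_ne_of_ne (by simpa using hx) (by simp)
      simp [mobiusFun, mobiusInv, this, hx]

end Mobius

section CarlitzRank

open Equiv Equiv.Perm

theorem optionCongr_mul {X : Type*} (f g : Perm X) :
    (f * g).optionCongr = f.optionCongr * g.optionCongr := by
  ext1 x
  cases x <;> simp

theorem exists_optionCongr_eq {X : Type*} [DecidableEq X] {h : Perm (Option X)} (hn : h none = none) :
    ∃ g : Perm X, g.optionCongr = h := by
  refine ⟨h.removeNone, ?_⟩
  ext1 x
  cases x with
  | none => simp [hn]
  | some x =>
    have : ∃ y, h (some x) = some y := by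
      rcases hx : h (some x) with _ | y
      · simpa using h.injective (hx.trans hn.symm)
      · exact ⟨y, rfl⟩
    rw [optionCongr_apply, Option.map_some]
    exact Equiv.removeNone_some h this

variable {F : Type*} [Field F]

theorem hasCRRep_zero_iff {ρ f : Perm F} : HasCRRep ρ f 0 ↔ IsAffinePerm f := by
  constructor
  · rintro ⟨θ, hθ, rfl⟩
    simpa using hθ 0
  · exact fun h => ⟨fun _ => f, fun _ => h, by simp⟩

theorem hasCRRep_succ_iff {ρ f : Perm F} {n : ℕ} :
    HasCRRep ρ f (n + 1) ↔ ∃ θ g, IsAffinePerm θ ∧ HasCRRep ρ g n ∧ f = θ * (ρ * g) := by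
  constructor
  · rintro ⟨θ, hθ, rfl⟩
    exact ⟨θ 0, _, hθ 0, ⟨fun i => θ i.succ, fun i => hθ _, rfl⟩,
      by simp [List.ofFn_succ, mul_assoc]⟩
  · rintro ⟨θ, g, hθ, ⟨η, hη, rfl⟩, rfl⟩
    refine ⟨Fin.cons θ η, fun i => ?_, by simp [List.ofFn_succ, mul_assoc]⟩
    cases i using Fin.cases <;> simp [hθ, hη]

variable [DecidableEq F]

theorem optionCongr_rho {ρ : Perm F} (hρ : ∀ a, ρ a = a⁻¹) :
    ρ.optionCongr = mobiusInv * swap (some 0) none := by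
  have : ρ = Equiv.inv F := by
    ext x
    simp [hρ]
  rw [mobiusInv, mul_assoc, swap_mul_self, mul_one, this]

theorem HasCRRep.exists_starProd {ρ : Perm F} (hρ : ∀ a, ρ a = a⁻¹) {f : Perm F} {n : ℕ}
    (h : HasCRRep ρ f n) :
    ∃ (M : Perm (Option F)) (l : List F), IsMobius M ∧ l.length = n ∧
      f.optionCongr = M * starProd l := by
  induction n generalizing f with
  | zero =>
    exact ⟨f.optionCongr, [], (hasCRRep_zero_iff.1 h).isMobius_optionCongr, rfl,
      by simp [starProd]⟩
  | succ n ih =>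
    obtain ⟨θ, g, hθ, hg, rfl⟩ := hasCRRep_succ_iff.1 h
    obtain ⟨M, l, hM, hl, hgM⟩ := ih hg
    refine ⟨θ.optionCongr * (mobiusInv * M), l ++ [g.symm 0],
      hθ.isMobius_optionCongr.mul (isMobius_mobiusInv.mul hM), by simp [hl], ?_⟩
    have hswap : swap (some 0) none * g.optionCongr =
        g.optionCongr * swap (some (g.symm 0)) none := by
      rw [mul_swap_eq_swap_mul]
      simp
    rw [optionCongr_mul, optionCongr_mul, optionCongr_rho hρ, starProd_append_singleton,
      mul_assoc mobiusInv, hswap, hgM]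
    simp only [mul_assoc]

theorem hasCRRep_of_eq_mul_starProd {ρ : Perm F} (hρ : ∀ a, ρ a = a⁻¹) {f : Perm F}
    {M : Perm (Option F)} (hM : IsMobius M) {l : List F}
    (h : f.optionCongr = M * starProd l) : HasCRRep ρ f l.length := by
  induction l using List.reverseRecOn generalizing f M with
  | nil =>
    rw [List.length_nil, hasCRRep_zero_iff]
    refine IsMobius.isAffinePerm ?_
    rw [h]
    simpa [starProd] using hM
  | append_singleton l b ih =>
    rw [List.length_append, List.length_singleton, hasCRRep_succ_iff]
    have hθ : IsAffinePerm (Equiv.addRight (f b)) := ⟨1, f b, one_ne_zero, by simp⟩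
    have hθ' : IsAffinePerm (Equiv.addRight (-f b)) := ⟨1, -f b, one_ne_zero, by simp⟩
    have hinv : (mobiusInv : Perm (Option F)) * mobiusInv = 1 := by
      ext1 x
      cases x with
      | none => simp [mobiusInv]
      | some x =>
        by_cases hx : x = 0
        · simp [mobiusInv, hx]
        · have : ∀ y : F, y ≠ 0 → swap (some 0) none (some y) = some y := fun y hy =>
            swap_apply_of_ne_of_ne (by simpa using hy) (by simp)
          simp [mobiusInv, this x hx, this x⁻¹ (inv_ne_zero hx)]
    have hcancel : (Equiv.addRight (f b)).optionCongr * (Equiv.addRight (-f b)).optionCongr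
        = 1 := by
      rw [← optionCongr_mul]
      ext1 x
      cases x <;> simp
    set k := mobiusInv * ((Equiv.addRight (-f b)).optionCongr *
      (f.optionCongr * swap (some b) none)) with hk
    have hkn : k none = none := by simp [hk, mobiusInv]
    have hkb : k (some b) = some 0 := by simp [hk, mobiusInv]
    obtain ⟨g, hg⟩ := exists_optionCongr_eq hkn
    refine ⟨_, g, hθ, ih (isMobius_mobiusInv.mul (hθ'.isMobius_optionCongr.mul hM)) ?_, ?_⟩
    · rw [hg, hk, h, starProd_append_singleton, mul_assoc M, mul_assoc (starProd l),
        swap_mul_self, mul_one, mul_assoc, mul_assoc]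
    · apply optionCongr_injective
      have hswap : swap (some 0) none * k = k * swap (some b) none := by
        rw [mul_swap_eq_swap_mul, hkb, hkn]
      rw [optionCongr_mul, optionCongr_mul, hg, optionCongr_rho hρ, mul_assoc, hswap, hk]
      simp only [mul_assoc, swap_mul_self, mul_one]
      rw [← mul_assoc mobiusInv, hinv, one_mul, ← mul_assoc, hcancel, one_mul]

end CarlitzRank

/-- if f = μ ∘ σ is a permutation of 𝔽_q (extended to ℙ¹(𝔽_q) fixing ∞),
with μ induced by a degree-one rational function, σ moving exactly s points of 𝔽_q and
having exactly t nontrivial orbits on ℙ¹(𝔽_q), and n := s + t if σ(∞) = ∞ while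
n := s + t − 1 otherwise, and if moreover q ≥ n + s + 2, then the Carlitz rank of f
is exactly n. -/
theorem carlitzRank_eq
    {F : Type*} [Field F] [Fintype F] [DecidableEq F]
    (hq : 2 < Fintype.card F)
    (ρ : Equiv.Perm F) (hρ : ∀ a : F, ρ a = a ^ (Fintype.card F - 2))
    (μ σ : Equiv.Perm (Option F)) (hμ : IsMobius μ)
    (f : Equiv.Perm F) (hf : f.optionCongr = μ * σ)
    (s t n : ℕ)
    (hs : (Finset.filter (fun x : F => σ (some x) ≠ some x) Finset.univ).card = s)
    (ht : Set.ncard {o : Set (Option F) | ∃ x, σ x ≠ x ∧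
            o = Set.range (fun m : ℤ => (σ ^ m) x)} = t)
    (hn : n = if σ none = none then s + t else s + t - 1)
    (hcard : n + s + 2 ≤ Fintype.card F) :
    sInf {m : ℕ | HasCRRep ρ f m} = n := by
  have hρ' : ∀ a : F, ρ a = a⁻¹ := fun a => by
    rw [hρ]
    by_cases ha : a = 0
    · rw [ha, inv_zero, zero_pow (by omega)]
    · refine eq_inv_of_mul_eq_one_left ?_
      rw [← pow_succ, show Fintype.card F - 2 + 1 = Fintype.card F - 1 by omega,
        FiniteField.pow_card_sub_one_eq_one a ha]
  have hL : starLength σ = n := by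
    have h1 := starLength_eq σ
    have hs' : (movedSome σ).card = s := hs
    have ht' : {o : Set (Option F) | ∃ x, σ x ≠ x ∧ o = σ.zpowOrbit x}.ncard = t := ht
    rw [h1, hs', ht', hn]
    split_ifs with h
    · simp
    · have h2 := ncard_nontrivial_orbits_pos h
      omega
  have hmem : HasCRRep ρ f n := by
    obtain ⟨l, rfl, hlen⟩ := exists_starProd σ
    obtain rfl : l.length = n := by omega
    exact hasCRRep_of_eq_mul_starProd hρ' hμ hf
  refine le_antisymm (Nat.sInf_le hmem) (le_csInf ⟨n, hmem⟩ fun m hm => ?_)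
  by_contra! hlt
  obtain ⟨M, l, hM, rfl, hfM⟩ := hm.exists_starProd hρ'
  have hcard' : 2 < (movedSome σ ∪ l.toFinset)ᶜ.card := by
    have h1 := Finset.card_union_le (movedSome σ) l.toFinset
    have h2 := l.toFinset_card_le
    have hs' : (movedSome σ).card = s := hs
    rw [Finset.card_compl]
    omega
  have hagree : ∀ x ∈ (movedSome σ ∪ l.toFinset)ᶜ, μ (some x) = M (some x) := by
    intro x hx
    rw [Finset.mem_compl, Finset.mem_union, not_or] at hx
    have h1 : σ (some x) = some x := by simpa [mem_movedSome] using hx.1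
    have h2 : starProd l (some x) = some x := by
      simpa [mem_movedSome] using fun h => hx.2 (movedSome_starProd_subset l h)
    have h3 := DFunLike.congr_fun (hf.symm.trans hfM) (some x)
    simpa [h1, h2] using h3
  obtain ⟨x, hx, y, hy, z, hz, hxy, hxz, hyz⟩ := Finset.two_lt_card.1 hcard'
  obtain rfl : μ = M :=
    hμ.eq_of_three_points hM hxy hxz hyz (hagree x hx) (hagree y hy) (hagree z hz)
  have hσ : σ = starProd l := mul_left_cancel (hf.symm.trans hfM)
  have := starLength_starProd_le l
  rw [← hσ] at this
  omega
end
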